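/- Let N ≥ 2 be an integer, g, h, u_m real numbers, and α₁ a nonzero real number. Then for every λ ∈ ℝ, det(A^{HSWME} − λ·I_{N+2}) = ((−α₁)^N · N! / (2N+1)!!) · P'_{N+1}((λ − u_m)/α₁) · ((λ − u_m)² − gh − α₁²). -/

import Mathlib

open Polynomial

/-- The Legendre polynomial of degree `n` (Rodrigues' formula), normalized so `P n 1 = 1`. -/
noncomputable def legendre (n : ℕ) : Polynomial ℝ :=
  ((2 ^ n * n.factorial : ℝ))⁻¹ • (derivative^[n] ((X ^ 2 - 1) ^ n))

/-- Entry `(i,j)` (0-based) of the tridiagonal matrix `A₂`. -/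
noncomputable def A2entry (α1 : ℝ) (i j : ℕ) : ℝ :=
  if j = i + 1 then ((i : ℝ) + 3) / (2 * (i : ℝ) + 5) * α1
  else if i = j + 1 then ((j : ℝ) + 1) / (2 * (j : ℝ) + 3) * α1
  else 0

/-- The HSWME system matrix in convective variables. -/
noncomputable def AHSWME (N : ℕ) (g h um α1 : ℝ) :
    Matrix (Fin (N + 2)) (Fin (N + 2)) ℝ := fun r c =>
  if r.val = 0 then (if c.val = 1 then 1 else 0)
  else if r.val = 1 then
    (if c.val = 0 then g * h - um ^ 2 - α1 ^ 2 / 3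
     else if c.val = 1 then 2 * um
     else if c.val = 2 then 2 / 3 * α1 else 0)
  else if c.val = 0 then
    (if r.val = 2 then -2 * um * α1 else if r.val = 3 then -(2 / 3) * α1 ^ 2 else 0)
  else if c.val = 1 then (if r.val = 2 then 2 * α1 else 0)
  else (if r = c then um else 0) + A2entry α1 (r.val - 2) (c.val - 2)

lemma legendre_smul (n : ℕ) :
    (2 ^ n * n.factorial : ℝ) • legendre n = derivative^[n] ((X ^ 2 - 1) ^ n) := by
  have : (2 ^ n * n.factorial : ℝ) ≠ 0 := by positivity
  rw [legendre, smul_smul, mul_inv_cancel₀ this, one_smul]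

lemma derivative_legendre_succ (n : ℕ) :
    derivative (legendre (n + 1)) =
      X * derivative (legendre n) + ((n : ℝ) + 1) • legendre n := by
  have hc : (2 ^ (n + 1) * (n + 1).factorial : ℝ) ≠ 0 := by positivity
  apply smul_right_injective ℝ[X] hc
  have h1 : derivative ((X ^ 2 - 1 : ℝ[X]) ^ (n + 1)) =
      ((2 : ℝ) * (n + 1)) • (X * (X ^ 2 - 1) ^ n) := by
    simp [derivative_pow_succ, smul_eq_C_mul, Polynomial.C_ofNat]
    ring
  have h2 := legendre_smul n
  have h3 : (2 ^ n * n.factorial : ℝ) • derivative (legendre n) =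
      derivative^[n + 1] ((X ^ 2 - 1) ^ n) := by
    rw [Function.iterate_succ_apply', ← h2, derivative_smul]
  dsimp only
  rw [← derivative_smul, legendre_smul, ← Function.iterate_succ_apply' derivative,
    Function.iterate_succ_apply, h1, iterate_derivative_smul, mul_comm X,
    iterate_derivative_mul_X, ← h3]
  simp only [Nat.add_sub_cancel, ← h2, Nat.factorial_succ]
  simp only [smul_eq_C_mul, nsmul_eq_mul]
  push_cast
  simp [Polynomial.C_ofNat]
  ring

lemma derivative_legendre_add_two (n : ℕ) :
    derivative (legendre (n + 2)) =
      derivative (legendre n) + (2 * (n : ℝ) + 3) • legendre (n + 1) := by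
  have hc : (2 ^ (n + 2) * (n + 2).factorial : ℝ) ≠ 0 := by positivity
  apply smul_right_injective ℝ[X] hc
  have h1 : derivative (derivative ((X ^ 2 - 1 : ℝ[X]) ^ (n + 2))) =
      ((2 : ℝ) * (n + 2) * (2 * n + 3)) • (X ^ 2 - 1) ^ (n + 1) +
        ((2 : ℝ) * (n + 2) * (2 * (n + 1))) • (X ^ 2 - 1) ^ n := by
    simp [derivative_pow_succ, smul_eq_C_mul, Polynomial.C_ofNat]
    ring
  have h2 := legendre_smul (n + 1)
  have h3 : (2 ^ n * n.factorial : ℝ) • derivative (legendre n) =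
      derivative^[n + 1] ((X ^ 2 - 1) ^ n) := by
    rw [Function.iterate_succ_apply', ← legendre_smul, derivative_smul]
  dsimp only
  rw [← derivative_smul, legendre_smul, ← Function.iterate_succ_apply' derivative,
    Function.iterate_succ_apply, Function.iterate_succ_apply, h1, iterate_map_add,
    iterate_derivative_smul, iterate_derivative_smul, ← h2, ← h3]
  simp only [Nat.factorial_succ]
  simp only [smul_eq_C_mul]
  push_cast
  simp [Polynomial.C_ofNat]
  ring

/-- The three-term recurrence satisfied by the derivatives of the Legendre polynomials. -/
lemma eval_derivative_legendre_recurrence (n : ℕ) (x : ℝ) :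
    ((n : ℝ) + 2) * (derivative (legendre (n + 3))).eval x =
      (2 * n + 5) * x * (derivative (legendre (n + 2))).eval x -
        (n + 3) * (derivative (legendre (n + 1))).eval x := by
  have h1 := congrArg (eval x) (derivative_legendre_succ (n + 2))
  have h2 := congrArg (eval x) (derivative_legendre_add_two (n + 1))
  simp only [eval_add, eval_mul, eval_smul, eval_X, smul_eq_mul] at h1 h2
  push_cast at h1 h2
  linear_combination (2 * (n : ℝ) + 5) * h1 - (n + 3) * h2

/-- Expansion of the determinant of a tridiagonal matrix along its last row. -/
lemma det_tridiagonal_add_two {R : Type*} [CommRing R] (T : ℕ → ℕ → R)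
    (hlow : ∀ i j, j + 1 < i → T i j = 0) (hup : ∀ i j, i + 1 < j → T i j = 0) (n : ℕ) :
    (Matrix.of fun i j : Fin (n + 2) => T i j).det =
      T (n + 1) (n + 1) * (Matrix.of fun i j : Fin (n + 1) => T i j).det -
        T n (n + 1) * T (n + 1) n * (Matrix.of fun i j : Fin n => T i j).det := by
  have hminor : ((Matrix.of fun i j : Fin (n + 2) => T i j).submatrix Fin.castSucc
      (Fin.last n).castSucc.succAbove).det =
        T n (n + 1) * (Matrix.of fun i j : Fin n => T i j).det := by
    rw [Matrix.det_succ_column _ (Fin.last n), Fin.sum_univ_castSucc, Finset.sum_eq_zero]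
    · have : ((Matrix.of fun i j : Fin (n + 2) => T i j).submatrix Fin.castSucc
          (Fin.last n).castSucc.succAbove).submatrix (Fin.last n).succAbove
            (Fin.last n).succAbove = Matrix.of fun i j : Fin n => T i j := by
        ext i j
        simp [Fin.succAbove, Fin.lt_def]
      rw [this]
      simp [Fin.succAbove, ← two_mul]
    · intro i _
      simp [Fin.succAbove, hup]
  rw [Matrix.det_succ_row _ (Fin.last (n + 1)), Fin.sum_univ_castSucc, Fin.sum_univ_castSucc,
    Finset.sum_eq_zero]
  · have : (Matrix.of fun i j : Fin (n + 2) => T i j).submatrix Fin.castSucc Fin.castSucc =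
        Matrix.of fun i j : Fin (n + 1) => T i j := rfl
    simp only [Fin.succAbove_last, hminor, this]
    simp [← two_mul, add_right_comm n 1 n, pow_add, pow_mul]
    ring
  · intro i _
    simp [hlow]

/-- The characteristic polynomial of the tridiagonal matrix `A₂`. -/
lemma det_A2 (μ α : ℝ) (hα : α ≠ 0) : ∀ n : ℕ,
    (Matrix.of fun i j : Fin n => (if (i : ℕ) = j then -μ else 0) + A2entry α i j).det =
      (-α) ^ n * (n.factorial : ℝ) / (Nat.doubleFactorial (2 * n + 1) : ℝ) *
        (derivative (legendre (n + 1))).eval (μ / α)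
  | 0 => by
    simp [legendre]
    norm_num
  | 1 => by
    simp [legendre, A2entry, Nat.doubleFactorial, derivative_pow]
    field_simp
    norm_num
  | n + 2 => by
    rw [det_tridiagonal_add_two (fun i j => (if i = j then -μ else 0) + A2entry α i j),
      det_A2 μ α hα (n + 1), det_A2 μ α hα n]
    · have h := eval_derivative_legendre_recurrence n (μ / α)
      have hf : (2 * (n + 2) + 1).doubleFactorial =
          (2 * n + 5) * ((2 * n + 3) * (2 * n + 1).doubleFactorial) := rfl
      have hf' : (2 * (n + 1) + 1).doubleFactorial =
          (2 * n + 3) * (2 * n + 1).doubleFactorial := rfl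
      have hd : ((2 * n + 1).doubleFactorial : ℝ) ≠ 0 := by
        exact_mod_cast (Nat.doubleFactorial_pos _).ne'
      obtain ⟨x, rfl⟩ : ∃ x, μ = x * α := ⟨μ / α, by field_simp⟩
      rw [mul_div_cancel_right₀ x hα] at h ⊢
      simp only [hf, hf', Nat.factorial_succ, A2entry, if_true, Nat.succ_ne_self, if_false,
        show n + 1 ≠ n + 1 + 1 by omega, show n ≠ n + 1 + 1 by omega, show n ≠ n + 1 by omega]
      push_cast
      field_simp
      linear_combination -(n + 1 : ℝ) * (-α) ^ (n + 2) * h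
    · intro i j hij
      simp [A2entry, show i ≠ j by omega, show j ≠ i + 1 by omega, show i ≠ j + 1 by omega]
    · intro i j hij
      simp [A2entry, show i ≠ j by omega, show j ≠ i + 1 by omega, show i ≠ j + 1 by omega]

/-- Column operations split a quadratic factor off the characteristic polynomial. -/
lemma det_AHSWME_sub (k : ℕ) (g h um α lam : ℝ) :
    (AHSWME (k + 2) g h um α - lam • (1 : Matrix (Fin (k + 4)) (Fin (k + 4)) ℝ)).det =
      ((lam - um) ^ 2 - g * h - α ^ 2) *
        (Matrix.of fun i j : Fin (k + 2) =>
          (if (i : ℕ) = j then -(lam - um) else 0) + A2entry α i j).det := by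
  set M := AHSWME (k + 2) g h um α - lam • (1 : Matrix (Fin (k + 4)) (Fin (k + 4)) ℝ) with hM
  set v : Fin (k + 4) → ℝ := fun i => if i = 1 then g * h + α ^ 2 - (lam - um) ^ 2 else 0 with hv
  have hcol : (M.updateCol 0 v).det = M.det := by
    have h1 := Matrix.det_updateCol_add_smul_self M (i := ⟨0, by omega⟩) (j := ⟨1, by omega⟩)
      (by simp) lam
    have h2 := Matrix.det_updateCol_add_smul_self
      (M.updateCol ⟨0, by omega⟩ fun k => M k ⟨0, by omega⟩ + lam • M k ⟨1, by omega⟩)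
      (i := ⟨0, by omega⟩) (j := ⟨2, by omega⟩) (by simp) (2 * α)
    rw [← h1, ← h2, Matrix.updateCol_idem]
    change (M.updateCol ⟨0, by omega⟩ v).det = _
    congr 2
    ext ⟨i, hi⟩
    have h02 : (⟨2, by omega⟩ : Fin (k + 4)) ≠ ⟨0, by omega⟩ := by simp
    simp only [Matrix.updateCol_self, Matrix.updateCol_ne h02, hv]
    have hone : (⟨i, hi⟩ : Fin (k + 4)) = 1 ↔ i = 1 := by
      rw [Fin.ext_iff]; rfl
    simp only [hone]
    rcases i with _ | _ | _ | _ | i <;>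
      simp only [hM, AHSWME, A2entry, Matrix.sub_apply, Matrix.smul_apply, Matrix.one_apply,
        Fin.mk.injEq] <;> norm_num
    · ring
    · ring
    · ring
    · split_ifs <;> first | omega | simp
  rw [← hcol, Matrix.det_succ_column_zero, Finset.sum_eq_single 1]
  · rw [Matrix.det_succ_row_zero, Finset.sum_eq_single 0]
    · have : (((M.updateCol 0 v).submatrix (Fin.succAbove 1) Fin.succ).submatrix Fin.succ
          (Fin.succAbove 0)) = Matrix.of fun i j : Fin (k + 2) =>
            (if (i : ℕ) = j then -(lam - um) else 0) + A2entry α i j := by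
        ext ⟨i, hi⟩ ⟨j, hj⟩
        simp only [Matrix.submatrix_apply, Fin.zero_succAbove, Fin.one_succAbove_succ,
          Matrix.updateCol_ne (Fin.succ_ne_zero _)]
        simp only [Matrix.of_apply, Fin.succ_mk, hM, AHSWME, Matrix.sub_apply,
          Matrix.smul_apply, Matrix.one_apply, Fin.mk.injEq]
        rcases eq_or_ne i j with rfl | hij
        · simp
          ring
        · simp [hij]
      have hentry : (M.updateCol 0 v).submatrix (Fin.succAbove 1) Fin.succ 0 0 = 1 := by
        simp only [Matrix.submatrix_apply, Fin.one_succAbove_zero,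
          Matrix.updateCol_ne (Fin.succ_ne_zero _)]
        simp [hM, AHSWME]
      rw [this, hentry]
      simp only [hv, Matrix.updateCol_self, if_true]
      simp only [Fin.val_zero, Fin.val_one, pow_zero, pow_one]
      ring
    · rintro ⟨i, hi⟩ _ hne
      have hentry : (M.updateCol 0 v).submatrix (Fin.succAbove 1) Fin.succ 0 ⟨i, hi⟩ = 0 := by
        simp only [Matrix.submatrix_apply, Fin.one_succAbove_zero,
          Matrix.updateCol_ne (Fin.succ_ne_zero _)]
        have : i ≠ 0 := by simpa using hne
        simp [hM, AHSWME, this]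
      rw [hentry]
      simp
    · simp
  · intro i _ hi
    simp [hv, hi]
  · simp

/-- Characteristic polynomial of the HSWME system matrix. -/
theorem stmt_3 (N : ℕ) (hN : 2 ≤ N) (g h um : ℝ) (α1 : ℝ) (hα1 : α1 ≠ 0) (lam : ℝ) :
    (AHSWME N g h um α1 - lam • (1 : Matrix (Fin (N + 2)) (Fin (N + 2)) ℝ)).det =
      (-α1) ^ N * (N.factorial : ℝ) / (Nat.doubleFactorial (2 * N + 1) : ℝ) *
        (derivative (legendre (N + 1))).eval ((lam - um) / α1) *
        ((lam - um) ^ 2 - g * h - α1 ^ 2) := by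
  obtain ⟨k, rfl⟩ := Nat.exists_eq_add_of_le' hN
  rw [det_AHSWME_sub, det_A2 _ _ hα1, mul_comm]
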